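/- arXiv:1401.2294 — 2 statements merged into one kernel-verified Lean document; each statement's English description precedes it below -/
import Mathlib

section
/- There exist a finite alphabet S and countable two-dimensional sofic shifts X, Y ⊆ S^{ℤ²} such that the universal extension A(X,Y) is not a sofic shift. -/
namespace QE

/-- A finite pattern over the alphabet `S` on the group of positions `V`:
a finite domain `D ⊆ V` together with an assignment of symbols to `D`. -/
def Pattern (V S : Type*) : Type _ :=
  Σ D : Finset V, {v : V // v ∈ D} → S

variable {V S T : Type*}

/-- The pattern `P` occurs in the configuration `x` (at some translate). -/
def occursIn [Add V] (P : Pattern V S) (x : V → S) : Prop :=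
  ∃ t : V, ∀ w : {v : V // v ∈ P.1}, x (t + w.1) = P.2 w

/-- The subshift defined by the set `F` of forbidden patterns. -/
def shiftOf [Add V] (F : Set (Pattern V S)) : Set (V → S) :=
  {x | ∀ P ∈ F, ¬ occursIn P x}

/-- `X` is a subshift: it is defined by some set of forbidden patterns. -/
def IsSubshift [Add V] (X : Set (V → S)) : Prop :=
  ∃ F : Set (Pattern V S), X = shiftOf F

/-- `X` is a subshift of finite type: defined by a finite set of forbidden patterns. -/
def IsSFT [Add V] (X : Set (V → S)) : Prop :=
  ∃ F : Set (Pattern V S), F.Finite ∧ X = shiftOf F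

/-- The language of `X`: all finite patterns occurring in some configuration of `X`. -/
def lang [Add V] (X : Set (V → S)) : Set (Pattern V S) :=
  {P | ∃ x ∈ X, occursIn P x}

/-- `φ` acts on `Z` as a block map: it is given by a local function on a finite neighborhood. -/
def IsBlockMapOn [Add V] (Z : Set (V → S)) (φ : (V → S) → V → T) : Prop :=
  ∃ (D : Finset V) (Φ : ({v : V // v ∈ D} → S) → T),
    ∀ x ∈ Z, ∀ t : V, φ x t = Φ fun w => x (t + w.1)

/-- `X` is a sofic shift: the image of an SFT (over some finite alphabet) under a block map. -/
def IsSofic [Add V] (X : Set (V → S)) : Prop :=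
  ∃ (T' : Type) (_ : Fintype T') (Z : Set (V → T')) (φ : (V → T') → V → S),
    IsSFT Z ∧ IsBlockMapOn Z φ ∧ φ '' Z = X

/-- `X` is a countably covered sofic shift: the image of a countable SFT under a block map. -/
def IsCountablyCovered [Add V] (X : Set (V → S)) : Prop :=
  ∃ (T' : Type) (_ : Fintype T') (Z : Set (V → T')) (φ : (V → T') → V → S),
    IsSFT Z ∧ Z.Countable ∧ IsBlockMapOn Z φ ∧ φ '' Z = X

/-- Fill the holes (`none`-symbols) of the pattern `P` using the pattern `Q`:
this is `P^{(Q)}`. -/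
def fill (P : Pattern V (Option S)) (Q : {v : V // v ∈ P.1} → S) : Pattern V S :=
  ⟨P.1, fun w => (P.2 w).getD (Q w)⟩

/-- The universal extension `A(X,Y)`, a subshift over the alphabet `Option S`
(`none` playing the role of the hole symbol `□`). -/
def univExt [Add V] (X Y : Set (V → S)) : Set (V → Option S) :=
  shiftOf {P : Pattern V (Option S) |
    ∃ Q : {v : V // v ∈ P.1} → S, (⟨P.1, Q⟩ : Pattern V S) ∈ lang Y ∧ fill P Q ∉ lang X}

/-- The existential extension `E(X,Y)`, a subshift over the alphabet `Option S`
(`none` playing the role of the hole symbol `□`). -/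
def existExt [Add V] (X Y : Set (V → S)) : Set (V → Option S) :=
  shiftOf {P : Pattern V (Option S) |
    ∀ Q : {v : V // v ∈ P.1} → S, (⟨P.1, Q⟩ : Pattern V S) ∈ lang Y → fill P Q ∉ lang X}

/-! ### Subshifts defined by local rules -/

/-- A rule that only inspects a finite window defines a subshift of finite type. -/
lemma isSFT_of_local [Add V] [Finite T] (D : Finset V) (R : (V → T) → Prop)
    (hR : ∀ z z', (∀ w ∈ D, z w = z' w) → R z → R z') :
    IsSFT {z : V → T | ∀ t, R fun w => z (t + w)} := by
  refine ⟨(fun f => (⟨D, f⟩ : Pattern V T)) ''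
    {f | ∀ z : V → T, (∀ w : {v // v ∈ D}, z w.1 = f w) → ¬ R z}, (Set.toFinite _).image _, ?_⟩
  ext z
  constructor
  · rintro hz P ⟨f, hf, rfl⟩ ⟨t, ht⟩
    exact hf (fun w => z (t + w)) ht (hz t)
  · intro hz t
    by_contra hn
    refine hz ⟨D, fun w => z (t + w.1)⟩ ⟨_, ?_, rfl⟩ ⟨t, fun w => rfl⟩
    intro z' hz' hR'
    exact hn (hR _ _ (fun w hw => hz' ⟨w, hw⟩) hR')

/-- A function that only inspects a finite window defines a block map. -/
lemma isBlockMapOn_of_local [Add V] [Inhabited T] (D : Finset V) (ψ : (V → T) → S)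
    (hψ : ∀ z z', (∀ w ∈ D, z w = z' w) → ψ z = ψ z') (Z : Set (V → T)) :
    IsBlockMapOn Z fun z t => ψ fun w => z (t + w) := by
  classical
  refine ⟨D, fun f => ψ fun w => if h : w ∈ D then f ⟨w, h⟩ else default, fun z _ t => ?_⟩
  exact hψ _ _ fun w hw => by simp [hw]

/-! ### Triangles cut out by three lines -/

/-- The position where a monotone Boolean sequence jumps. -/
def edge (p : ℤ → Bool) (x : ℤ) : Bool := p x && !p (x - 1)

lemma edge_unique {p : ℤ → Bool} (hp : Monotone p) {x y : ℤ}
    (hx : edge p x = true) (hy : edge p y = true) : x = y := by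
  simp only [edge, Bool.and_eq_true, Bool.not_eq_true'] at hx hy
  by_contra hne
  rcases lt_or_gt_of_ne hne with h | h
  · have := hp (show x ≤ y - 1 by omega)
    rw [hx.1, hy.2] at this
    exact absurd this (by decide)
  · have := hp (show y ≤ x - 1 by omega)
    rw [hy.1, hx.2] at this
    exact absurd this (by decide)

lemma countable_monotone_bool : {p : ℤ → Bool | Monotone p}.Countable := by
  refine ((Set.countable_range fun a : ℤ => fun x => decide (a ≤ x)).union
    (Set.toFinite {(fun _ => true : ℤ → Bool), fun _ => false}).countable).mono ?_
  intro p hp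
  by_cases h1 : ∃ x, p x = true
  · by_cases h0 : ∃ x, p x = false
    · left
      obtain ⟨y, hy⟩ := h0
      obtain ⟨a, ha, hmin⟩ := Int.exists_least_of_bdd (P := fun x => p x = true)
        ⟨y, fun z hz => by
          by_contra hlt
          have := hp (show z ≤ y by omega)
          rw [hz, hy] at this
          exact absurd this (by decide)⟩ h1
      refine ⟨a, funext fun x => ?_⟩
      by_cases hx : a ≤ x
      · have := hp hx
        rw [ha] at this
        simpa [hx] using (top_le_iff.1 this).symm
      · have : p x ≠ true := fun h => hx (hmin x h)
        simpa [hx] using this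
    · right; left
      push Not at h0
      exact funext fun x => by simpa using h0 x
  · right; right
    push Not at h1
    exact funext fun x => by simpa using h1 x

/-- The vertical, horizontal and antidiagonal lines given by the jumps of `p`, `q`, `r` cut out
a triangle; its right-angled corner (doubled diagonally) and its two other corners are marked. -/
def tri (p q r : ℤ → Bool) (v : ℤ × ℤ) : Fin 4 → Bool :=
  ![edge p v.1 && edge q v.2, edge p (v.1 + 1) && edge q (v.2 + 1),
    edge p v.1 && edge r (v.1 + v.2), edge q v.2 && edge r (v.1 + v.2)]

lemma tri_unique {p q r : ℤ → Bool} (hp : Monotone p) (hq : Monotone q) (hr : Monotone r)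
    {u v : ℤ × ℤ} {i : Fin 4} (hu : tri p q r u i = true) (hv : tri p q r v i = true) :
    u = v := by
  fin_cases i <;> simp [tri] at hu hv
  · exact Prod.ext (edge_unique hp hu.1 hv.1) (edge_unique hq hu.2 hv.2)
  · have h1 := edge_unique hp hu.1 hv.1
    have h2 := edge_unique hq hu.2 hv.2
    exact Prod.ext (by omega) (by omega)
  · have h1 := edge_unique hp hu.1 hv.1
    have h2 := edge_unique hr hu.2 hv.2
    exact Prod.ext (by omega) (by omega)
  · have h1 := edge_unique hq hu.1 hv.1
    have h2 := edge_unique hr hu.2 hv.2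
    exact Prod.ext (by omega) (by omega)

/-- Triangles all of whose markings are hidden except for those in a mask from `M`. -/
def triShift (M : Set (Fin 4 → Bool)) : Set (ℤ × ℤ → Fin 4 → Bool) :=
  {c | ∃ p q r : ℤ → Bool, Monotone p ∧ Monotone q ∧ Monotone r ∧
    ∃ m ∈ M, c = fun v => m ⊓ tri p q r v}

lemma triShift_countable (M : Set (Fin 4 → Bool)) : (triShift M).Countable := by
  have h := countable_monotone_bool
  refine ((h.prod (h.prod (h.prod (Set.to_countable M)))).image
    fun a v => a.2.2.2 ⊓ tri a.1 a.2.1 a.2.2.1 v).mono ?_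
  rintro c ⟨p, q, r, hp, hq, hr, m, hm, rfl⟩
  exact ⟨(p, q, r, m), ⟨hp, hq, hr, hm⟩, rfl⟩

/-- The local rule of the cover of `triShift M`. -/
def triRule (M : Set (Fin 4 → Bool)) (z : ℤ × ℤ → Bool × Bool × Bool × (Fin 4 → Bool)) : Prop :=
  ((z (0, 1)).1 = (z (0, 0)).1 ∧ (z (0, 0)).1 ≤ (z (1, 0)).1) ∧
  ((z (1, 0)).2.1 = (z (0, 0)).2.1 ∧ (z (0, 0)).2.1 ≤ (z (0, 1)).2.1) ∧
  ((z (1, -1)).2.2.1 = (z (0, 0)).2.2.1 ∧ (z (0, 0)).2.2.1 ≤ (z (1, 0)).2.2.1) ∧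
  ((z (1, 0)).2.2.2 = (z (0, 0)).2.2.2 ∧ (z (0, 1)).2.2.2 = (z (0, 0)).2.2.2) ∧
  (z (0, 0)).2.2.2 ∈ M

/-- The local function mapping the cover onto `triShift M`. -/
def triLocal (z : ℤ × ℤ → Bool × Bool × Bool × (Fin 4 → Bool)) : Fin 4 → Bool :=
  (z (0, 0)).2.2.2 ⊓
    ![((z (0, 0)).1 && !(z (-1, 0)).1) && ((z (0, 0)).2.1 && !(z (0, -1)).2.1),
      ((z (1, 0)).1 && !(z (0, 0)).1) && ((z (0, 1)).2.1 && !(z (0, 0)).2.1),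
      ((z (0, 0)).1 && !(z (-1, 0)).1) && ((z (0, 0)).2.2.1 && !(z (-1, 0)).2.2.1),
      ((z (0, 0)).2.1 && !(z (0, -1)).2.1) && ((z (0, 0)).2.2.1 && !(z (-1, 0)).2.2.1)]

lemma eq_zero_of_succ_eq {α : Type*} {f : ℤ → α} (h : ∀ n, f (n + 1) = f n) (n : ℤ) :
    f n = f 0 := by
  induction n using Int.induction_on with
  | zero => rfl
  | succ i ih => rw [h, ih]
  | pred i ih => rw [← ih, ← h (-(i : ℤ) - 1)]; congr 1; ring

lemma triShift_isSofic (M : Set (Fin 4 → Bool)) : IsSofic (triShift M) := by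
  refine ⟨Bool × Bool × Bool × (Fin 4 → Bool), inferInstance,
    {z | ∀ t, triRule M fun w => z (t + w)}, fun z t => triLocal fun w => z (t + w),
    isSFT_of_local {(0, 0), (1, 0), (0, 1), (1, -1)} _ ?_,
    isBlockMapOn_of_local {(0, 0), (1, 0), (-1, 0), (0, 1), (0, -1)} _ ?_ _, ?_⟩
  · intro z z' h hR
    simp only [Finset.mem_insert, Finset.mem_singleton, forall_eq_or_imp, forall_eq] at h
    simpa only [triRule, h] using hR
  · intro z z' h
    simp only [Finset.mem_insert, Finset.mem_singleton, forall_eq_or_imp, forall_eq] at h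
    simp only [triLocal, h]
  · ext c
    constructor
    · rintro ⟨z, hz, rfl⟩
      have hz' : ∀ x y, _ := fun x y => hz (x, y)
      simp only [triRule, Prod.mk_add_mk, add_zero, ← sub_eq_add_neg] at hz'
      have hp : ∀ x y, (z (x, y)).1 = (z (x, 0)).1 := fun x y =>
        eq_zero_of_succ_eq (f := fun y => (z (x, y)).1) (fun n => (hz' x n).1.1) y
      have hq : ∀ x y, (z (x, y)).2.1 = (z (0, y)).2.1 := fun x y =>
        eq_zero_of_succ_eq (f := fun x => (z (x, y)).2.1) (fun n => (hz' n y).2.1.1) x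
      have hr : ∀ x y, (z (x, y)).2.2.1 = (z (x + y, 0)).2.2.1 := fun x y => by
        have := eq_zero_of_succ_eq (f := fun n => (z (x + y + n, -n)).2.2.1)
          (fun n => by
            have := (hz' (x + y + n) (-n)).2.2.1.1
            rw [← this, ← add_assoc, neg_add']) (-y)
        simpa using this
      have hm : ∀ x y, (z (x, y)).2.2.2 = (z (0, 0)).2.2.2 := fun x y =>
        (eq_zero_of_succ_eq (f := fun y => (z (x, y)).2.2.2)
          (fun n => (hz' x n).2.2.2.1.2) y).trans
        (eq_zero_of_succ_eq (f := fun x => (z (x, 0)).2.2.2) (fun n => (hz' n 0).2.2.2.1.1) x)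
      refine ⟨fun x => (z (x, 0)).1, fun y => (z (0, y)).2.1, fun s => (z (s, 0)).2.2.1,
        monotone_int_of_le_succ fun n => (hz' n 0).1.2,
        monotone_int_of_le_succ fun n => (hz' 0 n).2.1.2,
        monotone_int_of_le_succ fun n => (hz' n 0).2.2.1.2,
        (z (0, 0)).2.2.2, (hz' 0 0).2.2.2.2, ?_⟩
      funext ⟨x, y⟩
      simp only [triLocal, tri, edge, Prod.mk_add_mk, add_zero, ← sub_eq_add_neg, hm x y,
        hp _ y, hq x, hr _ y, add_sub_cancel_right, sub_add_eq_add_sub]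
    · rintro ⟨p, q, r, hp, hq, hr, m, hm, rfl⟩
      refine ⟨fun v => (p v.1, q v.2, r (v.1 + v.2), m), ?_, ?_⟩
      · rintro ⟨x, y⟩
        simp only [triRule, Prod.mk_add_mk, add_zero, true_and, and_true]
        refine ⟨hp (by omega), hq (by omega), ⟨?_, hr (by omega)⟩, hm⟩
        congr 1; ring
      · funext ⟨x, y⟩
        simp only [triLocal, tri, edge, Prod.mk_add_mk, add_zero, ← sub_eq_add_neg,
          add_sub_cancel_right, sub_add_eq_add_sub]

/-! ### The universal extension on configurations of zeros and holes -/

open Classical in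
/-- The configuration with holes at the positions in `H` and zeros elsewhere. -/
noncomputable def holes (H : Set (ℤ × ℤ)) (v : ℤ × ℤ) : Option (Fin 4 → Bool) :=
  if v ∈ H then none else some ⊥

/-- The masks that do not show everything but the last corner. -/
def goodMasks : Set (Fin 4 → Bool) := {![true, true, true, false]}ᶜ

/-- If the doubled right-angled corner and the upper corner of a triangle are in the set,
then so is its remaining corner. -/
def TriClosed (H : Set (ℤ × ℤ)) : Prop :=
  ∀ x y s : ℤ, (x, y) ∈ H → (x - 1, y - 1) ∈ H → (x, y + s) ∈ H → (x + s, y) ∈ H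

lemma holes_mem_univExt {H : Set (ℤ × ℤ)} (hH : TriClosed H) :
    holes H ∈ univExt (triShift goodMasks) (triShift {⊤}) := by
  classical
  rintro P ⟨Q, ⟨_, ⟨p, q, r, hp, hq, hr, m, hm, rfl⟩, ⟨u, hu⟩⟩, hX⟩ ⟨t, ht⟩
  rw [Set.mem_singleton_iff] at hm
  subst hm
  simp only [top_inf_eq] at hu
  apply hX
  set d := t - u with hd
  refine ⟨fun v => if v + d ∈ H then tri p q r v else ⊥,
    ⟨p, q, r, hp, hq, hr, fun i => decide (∃ v, tri p q r v i = true ∧ v + d ∈ H), ?_, ?_⟩,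
    ⟨u, ?_⟩⟩
  · intro h
    rw [Set.mem_singleton_iff] at h
    obtain ⟨⟨x, y⟩, h0, hH0⟩ := of_decide_eq_true (congrFun h 0)
    obtain ⟨⟨x1, y1⟩, h1, hH1⟩ := of_decide_eq_true (congrFun h 1)
    obtain ⟨⟨x2, y2⟩, h2, hH2⟩ := of_decide_eq_true (congrFun h 2)
    have h3 := of_decide_eq_false (congrFun h 3)
    simp [tri] at h0 h1 h2
    have e1 := edge_unique hp h0.1 h1.1
    have e2 := edge_unique hq h0.2 h1.2
    have e3 := edge_unique hp h0.1 h2.1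
    obtain rfl : x1 = x - 1 := by omega
    obtain rfl : y1 = y - 1 := by omega
    subst e3
    apply h3
    refine ⟨(x + (y2 - y), y), ?_, ?_⟩
    · simp only [tri]
      simp [h0.2, show x + (y2 - y) + y = x + y2 by ring, h2.2]
    · have := hH (x + d.1) (y + d.2) (y2 - y) hH0
        (by convert hH1 using 1; ext <;> simp <;> ring)
        (by convert hH2 using 1; ext <;> simp; ring)
      convert this using 1
      ext <;> simp
      ring
  · funext v i
    simp only [Pi.inf_apply]
    by_cases hv : tri p q r v i = true
    · have : (∃ w, tri p q r w i = true ∧ w + d ∈ H) ↔ v + d ∈ H :=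
        ⟨fun ⟨w, hw, hwH⟩ => tri_unique hp hq hr hw hv ▸ hwH, fun h => ⟨v, hv, h⟩⟩
      by_cases hvH : v + d ∈ H <;> simp [this, hvH, hv]
    · rw [Bool.not_eq_true] at hv
      by_cases hvH : v + d ∈ H <;> simp [hvH, hv]
  · intro w
    have e : u + w.1 + d = t + w.1 := by rw [hd]; abel
    have h1 := ht w
    simp only [fill, e, ← h1, holes, ← hu w]
    split_ifs <;> rfl

lemma triClosed_of_holes_mem {H : Set (ℤ × ℤ)}
    (h : holes H ∈ univExt (triShift goodMasks) (triShift {⊤})) : TriClosed H := by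
  classical
  intro x y s ha ha' hb
  by_contra hc
  have mono : ∀ a : ℤ, Monotone fun x : ℤ => decide (a ≤ x) := fun a x y hxy => by
    simp only [Bool.le_iff_imp, decide_eq_true_eq]
    exact fun h => h.trans hxy
  have hedge : ∀ a : ℤ, edge (fun x : ℤ => decide (a ≤ x)) a = true := fun a => by
    simp [edge]
  let c := tri (fun n => decide (x ≤ n)) (fun n => decide (y ≤ n))
    fun n => decide (x + (y + s) ≤ n)
  let D : Finset (ℤ × ℤ) := {(x, y), (x - 1, y - 1), (x, y + s), (x + s, y)}
  refine h ⟨D, fun w => holes H w.1⟩ ⟨fun w => c w.1, ?_, ?_⟩ ⟨0, fun w => by simp⟩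
  · exact ⟨c, ⟨_, _, _, mono x, mono y, mono (x + (y + s)), ⊤, rfl, by simp [c]⟩,
      ⟨0, fun w => by simp⟩⟩
  · rintro ⟨_, ⟨p, q, r, hp, hq, hr, m, hm, rfl⟩, ⟨⟨t1, t2⟩, ht⟩⟩
    have ht' : ∀ w ∈ D, m ⊓ tri p q r ((t1, t2) + w) = (holes H w).getD (c w) :=
      fun w hw => ht ⟨w, hw⟩
    have h0 := congrFun (ht' (x, y) (by simp [D])) 0
    have h1 := congrFun (ht' (x - 1, y - 1) (by simp [D])) 1
    have h2 := congrFun (ht' (x, y + s) (by simp [D])) 2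
    have h3 := congrFun (ht' (x + s, y) (by simp [D])) 3
    simp [holes, ha, ha', hb, hc, c, tri, hedge] at h0 h1 h2 h3
    apply hm
    funext i
    fin_cases i
    · exact h0.1
    · exact h1.1
    · exact h2.1
    · by_contra hm3
      have := h3 (by simpa using hm3) h0.2.2
      rw [show t1 + (x + s) + (t2 + y) = t1 + x + (t2 + (y + s)) by ring, h2.2.2] at this
      exact absurd this (by simp)

/-! ### Gluing in sofic shifts -/

/-- The square `[a - k, a + l + k) × [b - k, b + l + k)`. -/
noncomputable def box (a b l k : ℤ) : Finset (ℤ × ℤ) :=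
  Finset.Ico (a - k) (a + l + k) ×ˢ Finset.Ico (b - k) (b + l + k)

lemma mem_box {a b l k : ℤ} {v : ℤ × ℤ} :
    v ∈ box a b l k ↔ (a - k ≤ v.1 ∧ v.1 < a + l + k) ∧ (b - k ≤ v.2 ∧ v.2 < b + l + k) := by
  simp [box]

/-- In a sofic shift, the contents of a square may be exchanged between configurations whose
preimages agree around its border. -/
lemma exists_glue {Z : Set (ℤ × ℤ → T)} {φ : (ℤ × ℤ → T) → ℤ × ℤ → S}
    (hZ : IsSFT Z) (hφ : IsBlockMapOn Z φ) :
    ∃ ρ : ℕ, ∀ (a b l : ℤ), ∀ z₁ ∈ Z, ∀ z₂ ∈ Z,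
      (∀ v ∈ box a b l (2 * ρ) \ box a b l 0, z₁ v = z₂ v) →
      ∃ z ∈ Z, (∀ v ∈ box a b l ρ, φ z v = φ z₁ v) ∧
        ∀ v ∉ box a b l ρ, φ z v = φ z₂ v := by
  classical
  obtain ⟨F, hF, rfl⟩ := hZ
  obtain ⟨D, Φ, hΦ⟩ := hφ
  let E : Finset (ℤ × ℤ) := D ∪ hF.toFinset.biUnion fun P => P.1
  let ρ : ℕ := E.sup fun v => max v.1.natAbs v.2.natAbs
  have hE : ∀ v ∈ E, (-(ρ : ℤ) ≤ v.1 ∧ v.1 ≤ ρ) ∧ (-(ρ : ℤ) ≤ v.2 ∧ v.2 ≤ ρ) := by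
    intro v hv
    have : max v.1.natAbs v.2.natAbs ≤ ρ :=
      Finset.le_sup (f := fun v : ℤ × ℤ => max v.1.natAbs v.2.natAbs) hv
    omega
  refine ⟨ρ, fun a b l z₁ h₁ z₂ h₂ heq => ?_⟩
  let z : ℤ × ℤ → T := fun v => if v ∈ box a b l 0 then z₁ v else z₂ v
  have hin : ∀ t ∈ box a b l ρ, ∀ w ∈ E, z (t + w) = z₁ (t + w) := by
    intro t ht w hw
    have := hE w hw
    by_cases h : t + w ∈ box a b l 0
    · simp [z, h]
    · have h2 : t + w ∈ box a b l (2 * ρ) := by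
        rw [mem_box] at ht ⊢
        simp only [Prod.fst_add, Prod.snd_add]
        omega
      simp [z, h, heq _ (Finset.mem_sdiff.2 ⟨h2, h⟩)]
  have hout : ∀ t ∉ box a b l ρ, ∀ w ∈ E, z (t + w) = z₂ (t + w) := by
    intro t ht w hw
    have := hE w hw
    have h : t + w ∉ box a b l 0 := by
      rw [mem_box] at ht ⊢
      simp only [Prod.fst_add, Prod.snd_add]
      omega
    simp [z, h]
  have hz : z ∈ shiftOf F := by
    rintro P hP ⟨t, ht⟩
    have hPE : ∀ w : {v // v ∈ P.1}, w.1 ∈ E := fun w =>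
      Finset.mem_union_right _ (Finset.mem_biUnion.2 ⟨P, hF.mem_toFinset.2 hP, w.2⟩)
    by_cases h : t ∈ box a b l ρ
    · exact h₁ P hP ⟨t, fun w => by rw [← ht w, hin t h _ (hPE w)]⟩
    · exact h₂ P hP ⟨t, fun w => by rw [← ht w, hout t h _ (hPE w)]⟩
  have hDE : ∀ w : {v // v ∈ D}, w.1 ∈ E := fun w => Finset.mem_union_left _ w.2
  refine ⟨z, hz, fun v hv => ?_, fun v hv => ?_⟩
  · rw [hΦ z hz, hΦ z₁ h₁]
    exact congrArg Φ (funext fun w => hin v hv _ (hDE w))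
  · rw [hΦ z hz, hΦ z₂ h₂]
    exact congrArg Φ (funext fun w => hout v hv _ (hDE w))

lemma card_box_sdiff (a b : ℤ) (l k : ℕ) :
    (box a b l (2 * k) \ box a b l 0).card = 8 * k * l + 16 * k ^ 2 := by
  have hsub : box a b l 0 ⊆ box a b l (2 * k) := fun v hv => by
    rw [mem_box] at hv ⊢
    omega
  rw [Finset.card_sdiff_of_subset hsub]
  simp only [box, Finset.card_product, Int.card_Ico]
  have h1 : ∀ c : ℤ, (c + l + 2 * k - (c - 2 * k)).toNat = l + 4 * k := fun c => by omega
  have h2 : ∀ c : ℤ, (c + l + 0 - (c - 0)).toNat = l := fun c => by omega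
  simp only [h1, h2]
  apply Nat.sub_eq_of_eq_add
  ring

/-! ### Encoding arbitrary data symmetrically about the diagonal -/

/-- The diagonal together with the points with even coordinates that lie in `W` or whose mirror
image does. -/
def mirrorSet (W : Set (ℤ × ℤ)) : Set (ℤ × ℤ) :=
  {v | v.1 = v.2 ∨ Even v.1 ∧ Even v.2 ∧ (v ∈ W ∨ v.swap ∈ W)}

lemma mirrorSet_triClosed (W : Set (ℤ × ℤ)) : TriClosed (mirrorSet W) := by
  intro x y s h1 h2 h3
  obtain rfl : x = y := by
    rcases h1 with h1 | ⟨h1, -, -⟩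
    · exact h1
    · rcases h2 with h2 | ⟨h2, -, -⟩
      · simp only at h2
        omega
      · exact absurd h1 (by rw [Int.even_sub_one] at h2; exact h2)
  rcases h3 with h3 | ⟨h3, h4, h5⟩
  · left
    simp only at h3 ⊢
    omega
  · exact Or.inr ⟨h4, h3, h5.symm⟩

lemma pow_card_lt (τ ρ : ℕ) : ∃ k : ℕ,
    τ ^ (8 * ρ * (2 * k) + 16 * ρ ^ 2) < 2 ^ (k * k) := by
  refine ⟨32 * τ * ρ + ρ + 1, ?_⟩
  set k := 32 * τ * ρ + ρ + 1 with hk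
  calc τ ^ (8 * ρ * (2 * k) + 16 * ρ ^ 2)
      ≤ (2 ^ τ) ^ (8 * ρ * (2 * k) + 16 * ρ ^ 2) :=
        Nat.pow_le_pow_left Nat.lt_two_pow_self.le _
    _ = 2 ^ (τ * (8 * ρ * (2 * k) + 16 * ρ ^ 2)) := (pow_mul _ _ _).symm
    _ < 2 ^ (k * k) := Nat.pow_lt_pow_right (by norm_num) ?_
  have h1 : ρ ^ 2 ≤ ρ * k := by
    rw [pow_two]
    exact Nat.mul_le_mul_left _ (by omega)
  calc τ * (8 * ρ * (2 * k) + 16 * ρ ^ 2) ≤ τ * (8 * ρ * (2 * k) + 16 * (ρ * k)) := by gcongr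
    _ = (32 * τ * ρ) * k := by ring
    _ < k * k := Nat.mul_lt_mul_of_pos_right (by omega) (by omega)

/-- The points of the square of side `2 * k` with lower left corner `(0, N)` encoding the data
`w`. -/
def dataSet (N : ℤ) (k : ℕ) (w : Fin k × Fin k → Bool) : Set (ℤ × ℤ) :=
  {v | ∃ i j : Fin k, w (i, j) = true ∧ v = (2 * (i : ℤ), N + 2 * (j : ℤ))}

lemma mem_dataSet {N : ℤ} {k : ℕ} {w : Fin k × Fin k → Bool} (i j : Fin k) :
    (2 * (i : ℤ), N + 2 * (j : ℤ)) ∈ dataSet N k w ↔ w (i, j) = true := by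
  constructor
  · rintro ⟨i', j', h, he⟩
    rw [Prod.mk.injEq] at he
    obtain rfl : i = i' := Fin.ext (by omega)
    obtain rfl : j = j' := Fin.ext (by omega)
    exact h
  · exact fun h => ⟨i, j, h, rfl⟩

lemma univExt_triShift_not_isSofic :
    ¬ IsSofic (univExt (triShift goodMasks) (triShift {⊤})) := by
  classical
  rintro ⟨T', _, Z, φ, hZ, hφ, himg⟩
  obtain ⟨ρ, hglue⟩ := exists_glue hZ hφ
  obtain ⟨k, hk⟩ := pow_card_lt (Fintype.card T') ρ
  let N : ℤ := 2 * (k + ρ)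
  have hpre : ∀ W : Set (ℤ × ℤ), ∃ z ∈ Z, φ z = holes (mirrorSet W) := fun W => by
    have := holes_mem_univExt (mirrorSet_triClosed W)
    rwa [← himg] at this
  choose ζ hζ hφζ using hpre
  let K := box 0 N ((2 * k : ℕ) : ℤ) (2 * ρ) \ box 0 N ((2 * k : ℕ) : ℤ) 0
  obtain ⟨w₁, w₂, hne, heq⟩ := Fintype.exists_ne_map_eq_of_card_lt
    (fun (w : Fin k × Fin k → Bool) (v : {v // v ∈ K}) => ζ (dataSet N k w) v.1) (by
      simp only [Fintype.card_fun, Fintype.card_coe, K, card_box_sdiff, Fintype.card_prod,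
        Fintype.card_fin, Fintype.card_bool]
      exact hk)
  obtain ⟨⟨i, j⟩, hij⟩ := Function.ne_iff.1 hne
  wlog h₁ : w₁ (i, j) = true generalizing w₁ w₂
  · exact this w₂ w₁ hne.symm heq.symm hij.symm (by
      cases h : w₂ (i, j) <;> simp_all)
  have h₂ : ¬ w₂ (i, j) = true := fun h => hij (h₁.trans h.symm)
  obtain ⟨z, hz, hin, hout⟩ := hglue 0 N ((2 * k : ℕ) : ℤ) _ (hζ (dataSet N k w₁)) _
    (hζ (dataSet N k w₂)) fun v hv => congrFun heq ⟨v, hv⟩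
  let B := box 0 N ((2 * k : ℕ) : ℤ) ρ
  let H : Set (ℤ × ℤ) := {v | (v ∈ B ∧ v ∈ mirrorSet (dataSet N k w₁)) ∨
    (v ∉ B ∧ v ∈ mirrorSet (dataSet N k w₂))}
  have hzH : φ z = holes H := by
    funext v
    by_cases hv : v ∈ B
    · rw [hin v hv, hφζ]
      simp [holes, H, hv]
    · rw [hout v hv, hφζ]
      simp [holes, H, hv]
  have hclosed : TriClosed H := by
    apply triClosed_of_holes_mem
    rw [← hzH, ← himg]
    exact ⟨z, hz, rfl⟩
  have hdiag : ∀ x : ℤ, (x, x) ∈ H := fun x => by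
    by_cases hv : (x, x) ∈ B
    · exact Or.inl ⟨hv, Or.inl rfl⟩
    · exact Or.inr ⟨hv, Or.inl rfl⟩
  have hi := i.2
  have hj := j.2
  have hc := hclosed (2 * i) (2 * i) (N + 2 * j - 2 * i) (hdiag _) (hdiag _) (by
    rw [add_sub_cancel]
    refine Or.inl ⟨?_, Or.inr ⟨even_two_mul _, ?_, Or.inl ((mem_dataSet i j).2 h₁)⟩⟩
    · rw [mem_box]
      simp only
      omega
    · exact ⟨k + ρ + j, by simp only [N]; ring⟩)
  rw [add_sub_cancel] at hc
  rcases hc with ⟨hc, -⟩ | ⟨-, hc⟩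
  · rw [mem_box] at hc
    simp only [N] at hc
    omega
  · rcases hc with hc | ⟨-, -, hc | hc⟩
    · simp only [N] at hc
      omega
    · obtain ⟨i', j', -, he⟩ := hc
      rw [Prod.mk.injEq] at he
      have := i'.2
      simp only [N] at he
      omega
    · exact h₂ ((mem_dataSet i j).1 hc)

/-- There are a finite alphabet `S` and countable two-dimensional sofic
shifts `X, Y ⊆ S^{ℤ²}` such that the universal extension `A(X,Y)` is not sofic. -/
theorem stmt8 :
    ∃ (S : Type) (_ : Fintype S) (X Y : Set ((ℤ × ℤ) → S)),
      IsSofic X ∧ X.Countable ∧ IsSofic Y ∧ Y.Countable ∧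
      ¬ IsSofic (univExt X Y) := by
  exact ⟨Fin 4 → Bool, inferInstance, triShift goodMasks, triShift {⊤}, triShift_isSofic _,
    triShift_countable _, triShift_isSofic _, triShift_countable _, univExt_triShift_not_isSofic⟩

end QE
end

section
/- Let S be a finite alphabet, let Y ⊆ S^{ℤ²} be a finite subshift, and let X ⊆ S^{ℤ²} be any sofic shift. Then the universal extension A(X,Y) is sofic. -/
namespace QE

variable {V S T : Type*}

/-- The translate of the configuration `x` by `t`. -/
def translate [Add V] (t : V) (x : V → S) : V → S := fun w => x (t + w)

/-- A condition on configurations is local if it only depends on finitely many positions. -/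
def IsLocal (C : (V → S) → Prop) : Prop :=
  ∃ D : Finset V, ∀ x x' : V → S, (∀ w ∈ D, x w = x' w) → C x → C x'

theorem IsLocal.and {C C' : (V → S) → Prop} (hC : IsLocal C) (hC' : IsLocal C') :
    IsLocal fun x => C x ∧ C' x := by
  classical
  obtain ⟨D, hD⟩ := hC
  obtain ⟨D', hD'⟩ := hC'
  refine ⟨D ∪ D', fun x x' h hx => ⟨hD x x' (fun w hw => h w ?_) hx.1,
    hD' x x' (fun w hw => h w ?_) hx.2⟩⟩ <;> simp [hw]

theorem IsLocal.forall {ι : Type*} [Finite ι] {C : ι → (V → S) → Prop}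
    (hC : ∀ i, IsLocal (C i)) : IsLocal fun x => ∀ i, C i x := by
  classical
  cases nonempty_fintype ι
  choose D hD using hC
  refine ⟨Finset.univ.biUnion D, fun x x' h hx i => hD i x x' (fun w hw => h w ?_) (hx i)⟩
  exact Finset.mem_biUnion.2 ⟨i, Finset.mem_univ i, hw⟩

theorem IsLocal.comap {C : (V → S) → Prop} (hC : IsLocal C) (f : T → S) :
    IsLocal fun x : V → T => C (f ∘ x) := by
  obtain ⟨D, hD⟩ := hC
  exact ⟨D, fun x x' h => hD _ _ fun w hw => congrArg f (h w hw)⟩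

theorem IsLocal.isSFT [Add V] [Finite S] {C : (V → S) → Prop} (hC : IsLocal C) :
    IsSFT {x | ∀ t, C (translate t x)} := by
  obtain ⟨D, hD⟩ := hC
  refine ⟨{P | P.1 = D ∧ ∃ x, (∀ w : {v // v ∈ P.1}, x w.1 = P.2 w) ∧ ¬ C x}, ?_, ?_⟩
  · refine (Set.finite_range fun p : {v // v ∈ D} → S => (⟨D, p⟩ : Pattern V S)).subset ?_
    rintro ⟨D', p⟩ ⟨rfl, -⟩
    exact ⟨p, rfl⟩
  · ext x
    constructor
    · rintro hx ⟨D', p⟩ ⟨rfl, x', hx', hC'⟩ ⟨t, ht⟩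
      exact hC' (hD _ _ (fun w hw => (ht ⟨w, hw⟩).trans (hx' ⟨w, hw⟩).symm) (hx t))
    · intro hx t
      by_contra h
      exact hx ⟨D, fun w => translate t x w.1⟩ ⟨rfl, translate t x, fun _ => rfl, h⟩
        ⟨t, fun _ => rfl⟩

theorem IsSFT.exists_isLocal [Add V] {X : Set (V → S)} (hX : IsSFT X) :
    ∃ C : (V → S) → Prop, IsLocal C ∧ X = {x | ∀ t, C (translate t x)} := by
  classical
  obtain ⟨F, hF, rfl⟩ := hX
  refine ⟨fun x => ∀ P ∈ F, ¬ ∀ w : {v // v ∈ P.1}, x w.1 = P.2 w,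
    ⟨hF.toFinset.biUnion Sigma.fst, ?_⟩, ?_⟩
  · intro x x' h hx P hP hw
    exact hx P hP fun w => (h w.1 (Finset.mem_biUnion.2 ⟨P, by simpa using hP, w.2⟩)).trans (hw w)
  · ext x
    exact ⟨fun hx t P hP hw => hx P hP ⟨t, hw⟩, fun hx P hP ⟨t, hw⟩ => hx t P hP hw⟩

theorem translate_mem_shiftOf [AddSemigroup V] {F : Set (Pattern V S)} {x : V → S}
    (hx : x ∈ shiftOf F) (t : V) : translate t x ∈ shiftOf F := by
  rintro P hP ⟨s, hs⟩
  exact hx P hP ⟨t + s, fun w => by rw [add_assoc]; exact hs w⟩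

theorem IsSofic.translate_mem [AddSemigroup V] {X : Set (V → S)} (hX : IsSofic X) {x : V → S}
    (hx : x ∈ X) (t : V) : translate t x ∈ X := by
  obtain ⟨T', _, Z, φ, ⟨F, -, rfl⟩, ⟨D, Φ, hφ⟩, rfl⟩ := hX
  obtain ⟨z, hz, rfl⟩ := hx
  have hz' := translate_mem_shiftOf hz t
  refine ⟨_, hz', funext fun v => ?_⟩
  rw [hφ _ hz', translate, hφ _ hz]
  simp only [translate, add_assoc]

theorem isClosed_shiftOf [Add V] [TopologicalSpace S] [DiscreteTopology S]
    (F : Set (Pattern V S)) : IsClosed (shiftOf F) := by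
  have h : shiftOf F = ⋂ P ∈ F, ⋂ t : V,
      (⋂ w : {v // v ∈ P.1}, {x : V → S | x (t + w.1) = P.2 w})ᶜ := by
    ext x
    simp only [shiftOf, occursIn, Set.mem_ofPred_eq, Set.mem_iInter, Set.mem_compl_iff, not_exists]
  rw [h]
  refine isClosed_biInter fun P _ => isClosed_iInter fun t => IsOpen.isClosed_compl ?_
  refine isOpen_iInter_of_finite fun w => ?_
  exact (isOpen_discrete ({P.2 w} : Set S)).preimage
    (continuous_apply (A := fun _ : V => S) (t + w.1))

theorem IsSofic.isClosed [Add V] [TopologicalSpace S] [DiscreteTopology S] {X : Set (V → S)}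
    (hX : IsSofic X) : IsClosed X := by
  obtain ⟨T', _, Z, φ, ⟨F, -, rfl⟩, ⟨D, Φ, hφ⟩, rfl⟩ := hX
  let _ : TopologicalSpace T' := ⊥
  have : DiscreteTopology T' := ⟨rfl⟩
  refine ((isClosed_shiftOf F).isCompact.image_of_continuousOn ?_).isClosed
  have hc : Continuous fun (x : V → T') (t : V) => Φ fun w => x (t + w.1) :=
    continuous_pi fun t => continuous_of_discreteTopology.comp
      (continuous_pi fun w => continuous_apply (t + w.1))
  exact hc.continuousOn.congr fun x hx => funext fun t => hφ x hx t

theorem IsSofic.mem_of_forall_lang [AddGroup V] {X : Set (V → S)} (hX : IsSofic X) {x : V → S}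
    (hx : ∀ D : Finset V, (⟨D, fun w => x w.1⟩ : Pattern V S) ∈ lang X) : x ∈ X := by
  let _ : TopologicalSpace S := ⊥
  have : DiscreteTopology S := ⟨rfl⟩
  rw [← hX.isClosed.closure_eq, mem_closure_iff]
  intro o ho hxo
  obtain ⟨I, u, hu, hI⟩ := isOpen_pi_iff.1 ho x hxo
  obtain ⟨x', hx', t, ht⟩ := hx I
  refine ⟨translate t x', hI fun w hw => ?_, hX.translate_mem hx' t⟩
  rw [translate, show x' (t + w) = x w from ht ⟨w, hw⟩]
  exact (hu w hw).2

theorem mem_univExt_iff [AddGroup V] {X Y : Set (V → S)} (hX : IsSofic X) (hY : IsSubshift Y)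
    {x : V → Option S} :
    x ∈ univExt X Y ↔ ∀ y ∈ Y, (fun v => (x v).getD (y v)) ∈ X := by
  constructor
  · intro hx y hy
    refine hX.mem_of_forall_lang fun D => ?_
    by_contra h
    exact hx ⟨D, fun w => x w.1⟩
      ⟨fun w => y w.1, ⟨y, hy, 0, fun w => by rw [zero_add]⟩, h⟩
      ⟨0, fun w => by rw [zero_add]⟩
  · rintro hx P ⟨Q, ⟨y, hy, s, hs⟩, hPQ⟩ ⟨t, ht⟩
    obtain ⟨F, rfl⟩ := hY
    refine hPQ ⟨_, hx _ (translate_mem_shiftOf hy (s + -t)), t, fun w => ?_⟩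
    simp only [fill, translate, add_assoc, neg_add_cancel_left, hs w]
    rw [ht w]

/-- The permutation of a subshift induced by translation by `t`. -/
def translatePerm [AddGroup V] {Y : Set (V → S)} (hY : IsSubshift Y) (t : V) : Equiv.Perm Y where
  toFun y := ⟨translate t y, by obtain ⟨F, rfl⟩ := hY; exact translate_mem_shiftOf y.2 t⟩
  invFun y := ⟨translate (-t) y, by obtain ⟨F, rfl⟩ := hY; exact translate_mem_shiftOf y.2 (-t)⟩
  left_inv y := by ext v; simp [translate]
  right_inv y := by ext v; simp [translate]

theorem translatePerm_apply [AddGroup V] {Y : Set (V → S)} (hY : IsSubshift Y) (t v : V) (y : Y) :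
    (translatePerm hY t y).1 v = y.1 (t + v) := rfl

theorem translatePerm_add [AddCommGroup V] {Y : Set (V → S)} (hY : IsSubshift Y) (s t : V) :
    translatePerm hY (s + t) = translatePerm hY s * translatePerm hY t := by
  ext y v
  simp only [Equiv.Perm.mul_apply, translatePerm_apply]
  rw [add_left_comm, add_assoc]

/-- A configuration of permutations that is equivariant along a generating set is equivariant. -/
theorem equivariant_of_closure_eq_top [AddCommGroup V] {Y : Set (V → S)} (hY : IsSubshift Y)
    {E : Set V} (hE : AddSubgroup.closure E = ⊤) {u : V → Equiv.Perm Y}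
    (hu : ∀ e ∈ E, ∀ v, u (v + e) = translatePerm hY e * u v) (t v : V) :
    u (v + t) = translatePerm hY t * u v := by
  have ht : t ∈ AddSubgroup.closure E := hE ▸ AddSubgroup.mem_top t
  have h0 : translatePerm hY 0 = 1 := by
    ext y w
    simp [translatePerm_apply]
  induction ht using AddSubgroup.closure_induction generalizing v with
  | mem e he => exact hu e he v
  | zero => rw [add_zero, h0, one_mul]
  | add s t _ _ hs ht => rw [← add_assoc, ht, hs, add_comm s t, ← mul_assoc, translatePerm_add]
  | neg t _ ht =>
    have h := ht (v + -t)
    rw [neg_add_cancel_right] at h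
    rw [h, ← mul_assoc, ← translatePerm_add, neg_add_cancel, h0, one_mul]

/-- Over a finitely generated abelian group, the universal extension of a sofic shift with respect
to a finite subshift is sofic. A cover records, for each `y ∈ Y`, a preimage of the configuration
filled with `y`; a layer of permutations of `Y` keeps track of the translates of each `y`. -/
theorem IsSofic.univExt {V S : Type} [AddCommGroup V] [AddGroup.FG V] [Finite S]
    {X Y : Set (V → S)} (hX : IsSofic X) (hY : IsSubshift Y) (hYfin : Y.Finite) :
    IsSofic (univExt X Y) := by
  classical
  have hX' := hX
  obtain ⟨T', _, Z, φ, hZ, ⟨D, Φ, hφ⟩, hφZ⟩ := hX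
  obtain ⟨C, hC, hZC⟩ := hZ.exists_isLocal
  obtain ⟨E, hE⟩ := AddGroup.fg_def.1 ‹AddGroup.FG V›
  have : Finite Y := hYfin
  let A := Option S × Equiv.Perm Y × (Y → T')
  let C₁ : (V → A) → Prop := fun x => ∀ e : E, (x e).2.1 = translatePerm hY e * (x 0).2.1
  let C₂ : (V → A) → Prop := fun x => ∀ y : Y, C ((fun a : A => a.2.2 y) ∘ x)
  let C₃ : (V → A) → Prop := fun x => ∀ y : Y,
    Φ (fun w => (x w.1).2.2 y) = (x 0).1.getD (((x 0).2.1 y).1 0)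
  have h₁ : IsLocal C₁ := .forall fun e => ⟨{0, e.1}, fun x x' h hx => by
    beta_reduce
    rwa [← h 0 (by simp), ← h e.1 (by simp)]⟩
  have h₂ : IsLocal C₂ := .forall fun y => hC.comap _
  have h₃ : IsLocal C₃ := .forall fun y => ⟨insert 0 D, fun x x' h hx => by
    beta_reduce
    rw [← h 0 (by simp), ← hx]
    congr 1
    funext w
    rw [h w.1 (by simp)]⟩
  refine ⟨A, Fintype.ofFinite A, {x | ∀ t, C₁ (translate t x) ∧ C₂ (translate t x) ∧
    C₃ (translate t x)}, fun x v => (x v).1, (h₁.and (h₂.and h₃)).isSFT,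
    ⟨{0}, fun p => (p ⟨0, by simp⟩).1, fun x _ t => by simp⟩, ?_⟩
  ext x
  rw [mem_univExt_iff hX' hY]
  constructor
  · rintro ⟨x, hx, rfl⟩ y hy
    have hu := equivariant_of_closure_eq_top hY hE (u := fun v => (x v).2.1) fun e he v => by
      simpa [translate] using (hx v).1 ⟨e, he⟩
    obtain ⟨y', hy'⟩ := (x 0).2.1.surjective ⟨y, hy⟩
    have hz : (fun v => (x v).2.2 y') ∈ Z := by
      rw [hZC]
      exact fun t => (hx t).2.1 y'
    rw [← hφZ]
    refine ⟨_, hz, funext fun v => ?_⟩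
    have h := (hx v).2.2 y'
    have huv := hu v 0
    simp only [zero_add] at huv
    simp only [translate, add_zero, huv, Equiv.Perm.mul_apply, hy', translatePerm_apply] at h
    rw [hφ _ hz]
    exact h
  · intro hx
    rw [← hφZ] at hx
    choose z hz hzx using fun y : Y => hx y.1 y.2
    refine ⟨fun v => (x v, translatePerm hY v, fun y => z y v), fun t => ⟨fun e => ?_, fun y => ?_,
      fun y => ?_⟩, rfl⟩
    · simp only [translate, add_zero]
      rw [add_comm, translatePerm_add]
    · have h := hz y
      rw [hZC] at h
      exact h t
    · have h := congrFun (hzx y) t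
      rw [hφ _ (hz y)] at h
      simpa [translate, translatePerm_apply] using h

/-- If `Y ⊆ S^{ℤ²}` is a finite subshift and `X ⊆ S^{ℤ²}` is any sofic
shift, then the universal extension `A(X,Y)` is sofic. -/
theorem stmt11 (S : Type) [Fintype S] (Y : Set ((ℤ × ℤ) → S))
    (hYsub : IsSubshift Y) (hYfin : Y.Finite)
    (X : Set ((ℤ × ℤ) → S)) (hX : IsSofic X) :
    IsSofic (univExt X Y) := by
  exact hX.univExt hYsub hYfin

end QE
end
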